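/- arXiv:1105.2709 — 2 statements merged into one kernel-verified Lean document; each statement's English description precedes it below -/
import Mathlib

section
/- For arbitrary n, m ≥ 1 there exists a general Unextendible Product Basis in ℂ^n ⊗ ℂ^m consisting of exactly m + n − 1 product vectors; that is, there exist nonzero vectors φ_1, …, φ_{m+n−1} ∈ ℂ^n and ψ_1, …, ψ_{m+n−1} ∈ ℂ^m such that no nonzero product vector f ⊗ g is orthogonal to all the vectors φ_i ⊗ ψ_i. -/
open scoped ComplexConjugate

/-- The standard Hermitian inner product, conjugate-linear in the first argument. -/
noncomputable def hinner {α : Type*} [Fintype α] (x y : α → ℂ) : ℂ :=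
  ∑ a, conj (x a) * y a

/-- The product vector `φ ⊗ ψ` in `ℂ^n ⊗ ℂ^m`, identified with `Fin n × Fin m → ℂ`. -/
noncomputable def prodVec {n m : ℕ} (φ : Fin n → ℂ) (ψ : Fin m → ℂ) :
    Fin n × Fin m → ℂ :=
  fun p => φ p.1 * ψ p.2

lemma hinner_prodVec {n m : ℕ} (φ f : Fin n → ℂ) (ψ g : Fin m → ℂ) :
    hinner (prodVec φ ψ) (prodVec f g) = hinner φ f * hinner ψ g := by
  simp only [hinner, prodVec, Fintype.sum_prod_type, Finset.sum_mul_sum, map_mul]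
  exact Finset.sum_congr rfl fun _ _ => Finset.sum_congr rfl fun _ _ => by ring

/-- The inner product with a moment-curve vector evaluates a polynomial. -/
lemma hinner_natCast_pow {n : ℕ} (t : ℕ) (f : Fin n → ℂ) :
    hinner (fun a : Fin n => (t : ℂ) ^ (a : ℕ)) f = (Polynomial.ofFn n f).eval (t : ℂ) := by
  rw [Polynomial.ofFn_eq_sum_monomial, Polynomial.eval_finsetSum]
  simp [hinner, Polynomial.eval_monomial, mul_comm]

lemma Polynomial.ofFn_ne_zero {n : ℕ} {f : Fin n → ℂ} (hf : f ≠ 0) :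
    Polynomial.ofFn n f ≠ 0 :=
  fun h => hf (Polynomial.injective_ofFn n (h.trans (map_zero _).symm))

lemma natCast_pow_fun_ne_zero {n : ℕ} (hn : 1 ≤ n) (t : ℕ) :
    (fun a : Fin n => (t : ℂ) ^ (a : ℕ)) ≠ 0 :=
  fun h => by simpa using congrFun h ⟨0, hn⟩

theorem stmt2 (n m : ℕ) (hn : 1 ≤ n) (hm : 1 ≤ m) :
    ∃ (φ : Fin (m + n - 1) → Fin n → ℂ) (ψ : Fin (m + n - 1) → Fin m → ℂ),
      (∀ i, φ i ≠ 0) ∧ (∀ i, ψ i ≠ 0) ∧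
      ¬ ∃ (f : Fin n → ℂ) (g : Fin m → ℂ), f ≠ 0 ∧ g ≠ 0 ∧
        ∀ i, hinner (prodVec (φ i) (ψ i)) (prodVec f g) = 0 := by
  refine ⟨fun i a => ((i : ℕ) : ℂ) ^ (a : ℕ), fun i b => ((i : ℕ) : ℂ) ^ (b : ℕ),
    fun i => natCast_pow_fun_ne_zero hn i, fun i => natCast_pow_fun_ne_zero hm i, ?_⟩
  rintro ⟨f, g, hf, hg, h⟩
  refine mul_ne_zero (Polynomial.ofFn_ne_zero hf) (Polynomial.ofFn_ne_zero hg) ?_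
  refine Polynomial.eq_zero_of_natDegree_lt_card_of_eval_eq_zero _
    (f := fun i : Fin (m + n - 1) => ((i : ℕ) : ℂ))
    (Nat.cast_injective.comp Fin.val_injective) (fun i => ?_) ?_
  · rw [Polynomial.eval_mul, ← hinner_natCast_pow, ← hinner_natCast_pow, ← hinner_prodVec]
    exact h i
  · have hF := Polynomial.ofFn_natDegree_lt hn f
    have hG := Polynomial.ofFn_natDegree_lt hm g
    have hFG := Polynomial.natDegree_mul_le (p := Polynomial.ofFn n f) (q := Polynomial.ofFn m g)
    rw [Fintype.card_fin]
    omega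
end

section
/- Let l ≥ 1 and n_1, …, n_l ≥ 1, and for each i = 1, …, N let φ^1_i ∈ ℂ^{n_1}, …, φ^l_i ∈ ℂ^{n_l} be nonzero vectors, where N ≥ (Σ_{i=1}^l n_i) − l + 1. The family of product vectors {φ^1_i ⊗ φ^2_i ⊗ … ⊗ φ^l_i}_{i=1}^N in ℂ^{n_1} ⊗ … ⊗ ℂ^{n_l} is a general Unextendible Product Basis (i.e., no nonzero product vector g_1 ⊗ … ⊗ g_l is orthogonal to all of them) if and only if for every partition of {1, …, N} into pairwise disjoint subsets 𝒩_1, …, 𝒩_l with ⋃_{i=1}^l 𝒩_i = {1, …, N}, there exists some i ∈ {1, …, l} such that the vectors {φ^i_j : j ∈ 𝒩_i} span ℂ^{n_i}. -/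
open scoped ComplexConjugate

/-- The multipartite product vector `φ^1 ⊗ ⋯ ⊗ φ^l`. -/
noncomputable def prodVecM {l : ℕ} {nn : Fin l → ℕ} (f : ∀ i, Fin (nn i) → ℂ) :
    (∀ i, Fin (nn i)) → ℂ :=
  fun j => ∏ i, f i (j i)

/-- The inner product of two product vectors is the product of the inner products. -/
theorem hinner_prodVecM {l : ℕ} {nn : Fin l → ℕ} (f g : ∀ i, Fin (nn i) → ℂ) :
    hinner (prodVecM f) (prodVecM g) = ∏ i, hinner (f i) (g i) := by
  simp only [hinner, prodVecM, Finset.prod_univ_sum, Fintype.piFinset_univ, map_prod,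
    Finset.prod_mul_distrib]

open scoped ComplexOrder in
theorem hinner_self_eq_zero {α : Type*} [Fintype α] {x : α → ℂ} : hinner x x = 0 ↔ x = 0 :=
  dotProduct_star_self_eq_zero

/-- A family of vectors spans iff only the zero vector is orthogonal to it. -/
theorem span_eq_top_iff_forall_hinner {α : Type*} [Fintype α] (S : Set (α → ℂ)) :
    Submodule.span ℂ S = ⊤ ↔ ∀ g : α → ℂ, (∀ s ∈ S, hinner s g = 0) → g = 0 := by
  classical
  constructor
  · intro h g hg
    have key : ∀ x ∈ Submodule.span ℂ S, hinner x g = 0 := by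
      intro x hx
      induction hx using Submodule.span_induction with
      | mem x hx => exact hg x hx
      | zero => simp [hinner]
      | add x y _ _ hx hy =>
        simp only [hinner] at hx hy
        simp [hinner, add_mul, Finset.sum_add_distrib, hx, hy]
      | smul c x _ hx =>
        simp only [hinner] at hx
        simp [hinner, mul_assoc, ← Finset.mul_sum, hx]
    exact hinner_self_eq_zero.1 (key g (h ▸ Submodule.mem_top))
  · intro h
    by_contra hS
    obtain ⟨f, hf, hle⟩ := Submodule.exists_le_ker_of_lt_top _ (lt_top_iff_ne_top.2 hS)
    have hconj : ∀ x, hinner x (fun a => conj (f fun j => if a = j then 1 else 0)) =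
        conj (f x) := by
      intro x
      conv_rhs => rw [LinearMap.pi_apply_eq_sum_univ f x]
      simp only [hinner, map_sum, smul_eq_mul, map_mul]
    have hzero := h _ fun s hs => by
      rw [hconj, LinearMap.mem_ker.1 (hle (Submodule.subset_span hs)), map_zero]
    refine hf (LinearMap.ext fun x => ?_)
    rw [LinearMap.zero_apply, ← map_eq_zero (starRingEnd ℂ), ← hconj, hzero]
    simp [hinner]

theorem stmt4 (l N : ℕ) (hl : 1 ≤ l) (nn : Fin l → ℕ) (hnn : ∀ i, 1 ≤ nn i)
    (hN : (∑ i, nn i) - l + 1 ≤ N)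
    (φ : Fin N → ∀ i, Fin (nn i) → ℂ) (hφ : ∀ t i, φ t i ≠ 0) :
    (¬ ∃ g : ∀ i, Fin (nn i) → ℂ, (∀ i, g i ≠ 0) ∧
        ∀ t, hinner (prodVecM (φ t)) (prodVecM g) = 0) ↔
      (∀ 𝒩 : Fin l → Finset (Fin N),
        (∀ i j, i ≠ j → Disjoint (𝒩 i) (𝒩 j)) → (∀ t, ∃ i, t ∈ 𝒩 i) →
        ∃ i, Submodule.span ℂ ((fun t => φ t i) '' ↑(𝒩 i)) = ⊤) := by
  constructor
  · intro h 𝒩 _ hcov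
    by_contra! hspan
    simp only [ne_eq, span_eq_top_iff_forall_hinner, not_forall] at hspan
    choose g hg hg0 using hspan
    refine h ⟨g, hg0, fun t => ?_⟩
    obtain ⟨i, hi⟩ := hcov t
    rw [hinner_prodVecM]
    exact Finset.prod_eq_zero (Finset.mem_univ i) (hg i _ ⟨t, hi, rfl⟩)
  · rintro h ⟨g, hg0, hg⟩
    simp only [hinner_prodVecM, Finset.prod_eq_zero_iff, Finset.mem_univ, true_and] at hg
    choose c hc using hg
    obtain ⟨i, hi⟩ := h (fun i => {t | c t = i})
      (fun i j hij => Finset.disjoint_left.2 fun t hti htj => hij <| by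
        simp only [Finset.mem_filter_univ] at hti htj
        exact hti.symm.trans htj)
      (fun t => ⟨c t, by simp⟩)
    refine hg0 i ((span_eq_top_iff_forall_hinner _).1 hi (g i) ?_)
    rintro _ ⟨t, ht, rfl⟩
    obtain rfl : c t = i := by simpa using ht
    exact hc t
end
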